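/- The family gamma -> (1/T^2 - gamma omega)/(1/T^2 - gamma(alpha omega)), indexed by gamma in Gamma, is multipliable, and its product u_alpha(1/T^2) satisfies |u_alpha(1/T^2) - pi^2| < 2^{-6}, where pi = 1/T. (Part of Proposition 8.1 of the paper.) -/

import Mathlib

open Polynomial Matrix
open scoped Classical

/-- The absolute value on `K_∞ = F₂((π))`: `|x| = 2^{-v_∞(x)}`. -/
noncomputable def absK2 (x : LaurentSeries (ZMod 2)) : ℝ :=
  if x = 0 then 0 else (2 : ℝ) ^ (-(HahnSeries.order x))

/-- The element `T = π⁻¹` of `K_∞ = F₂((π))`. -/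
noncomputable def Tel2 : LaurentSeries (ZMod 2) :=
  HahnSeries.single (-1 : ℤ) 1

/-- The embedding `A = F₂[T] → C`, sending `T` to `π⁻¹`. -/
noncomputable def polyEmb2 (C : Type*) [NormedField C]
    [Algebra (LaurentSeries (ZMod 2)) C] : Polynomial (ZMod 2) →+* C :=
  (algebraMap (LaurentSeries (ZMod 2)) C).comp (Polynomial.aeval Tel2).toRingHom

/-- The action of a matrix over `A = F₂[T]` on `C` by fractional linear
transformations. -/
noncomputable def act2 {C : Type*} [NormedField C] [Algebra (LaurentSeries (ZMod 2)) C]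
    (g : Matrix (Fin 2) (Fin 2) (Polynomial (ZMod 2))) (z : C) : C :=
  (polyEmb2 C (g 0 0) * z + polyEmb2 C (g 0 1)) /
    (polyEmb2 C (g 1 0) * z + polyEmb2 C (g 1 1))

/-- `Γ = Γ₀(T³) = {[[a,b],[c,d]] : a,b,c,d ∈ F₂[T], ad - bc = 1, T³ ∣ c}`. -/
def Gamma0T3 : Set (Matrix (Fin 2) (Fin 2) (Polynomial (ZMod 2))) :=
  {g | g.det = 1 ∧ (Polynomial.X : Polynomial (ZMod 2)) ^ 3 ∣ g 1 0}

/-- The matrix `α = [[T²+T+1, 1],[T³, 1+T]] ∈ Γ₀(T³)`. -/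
noncomputable def alpha2 : Matrix (Fin 2) (Fin 2) (Polynomial (ZMod 2)) :=
  !![Polynomial.X ^ 2 + Polynomial.X + 1, 1; Polynomial.X ^ 3, 1 + Polynomial.X]

/-- The polynomial over `F₂` whose coefficient vector is the binary expansion of `n`. -/
noncomputable def bitPoly (n : ℕ) : (ZMod 2)[X] :=
  ∑ i ∈ Finset.range n.size, if n.testBit i then X ^ i else 0

/-- Carry-less multiplication of binary expansions, reading at most `k` bits of `b`. -/
def clmulAux (a : ℕ) : ℕ → ℕ → ℕ
  | 0, _ => 0
  | k + 1, b => Nat.xor (Nat.mul (Nat.mod b 2) a) (Nat.mul 2 (clmulAux a k (Nat.div b 2)))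

/-- Carry-less multiplication of binary expansions. -/
def clmul (a b : ℕ) : ℕ := clmulAux a (b.log2 + 1) b

lemma bitPoly_coeff (n i : ℕ) : (bitPoly n).coeff i = if n.testBit i then 1 else 0 := by
  have h (j : ℕ) : (if n.testBit j then (X : (ZMod 2)[X]) ^ j else 0).coeff i =
      if i = j then (if n.testBit j then 1 else 0) else 0 := by
    split_ifs <;> simp_all [coeff_X_pow]
  simp only [bitPoly, finsetSum_coeff, h, Finset.sum_ite_eq, Finset.mem_range]
  split_ifs with h1 h2 <;> try rfl
  rw [not_lt, Nat.size_le] at h1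
  simp_all [Nat.testBit_lt_two_pow h1]

lemma bitPoly_injective : Function.Injective bitPoly := fun m n h => by
  refine Nat.eq_of_testBit_eq fun i => ?_
  have := congrArg (fun p => p.coeff i) h
  simp only [bitPoly_coeff] at this
  split_ifs at this <;> simp_all

@[simp] lemma bitPoly_zero : bitPoly 0 = 0 := by ext i; simp [bitPoly_coeff]

@[simp] lemma bitPoly_one : bitPoly 1 = 1 := by
  ext i; simp [bitPoly_coeff, coeff_one, Nat.testBit_one_eq_true_iff_self_eq_zero]

lemma bitPoly_xor (m n : ℕ) : bitPoly (m ^^^ n) = bitPoly m + bitPoly n := by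
  have h : (1 : ZMod 2) + 1 = 0 := by decide
  ext i
  simp only [bitPoly_coeff, coeff_add, Nat.testBit_xor]
  cases m.testBit i <;> cases n.testBit i <;> simp [h]

lemma bitPoly_two_mul (n : ℕ) : bitPoly (2 * n) = X * bitPoly n := by
  ext i
  rcases i with _ | i
  · simp [bitPoly_coeff]
  · simp [bitPoly_coeff, Nat.testBit_succ]

lemma bitPoly_mod_add_div (n : ℕ) : bitPoly n = bitPoly (n % 2) + X * bitPoly (n / 2) := by
  have hn : n % 2 = 0 ∨ n % 2 = 1 := by omega
  ext i
  rcases i with _ | i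
  · simp [bitPoly_coeff]
  · rcases hn with h | h <;>
      simp [h, coeff_one, bitPoly_coeff, Nat.testBit_succ]

lemma bitPoly_clmulAux (a k b : ℕ) (hb : b < 2 ^ k) :
    bitPoly (clmulAux a k b) = bitPoly a * bitPoly b := by
  induction k generalizing b with
  | zero => obtain rfl : b = 0 := by simpa using hb
            simp [clmulAux]
  | succ k ih =>
    change bitPoly ((b % 2 * a) ^^^ (2 * clmulAux a k (b / 2))) = _
    have hn : b % 2 = 0 ∨ b % 2 = 1 := by omega
    rw [bitPoly_xor, bitPoly_two_mul, ih _ (by omega), bitPoly_mod_add_div b]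
    rcases hn with h | h <;> simp [h] <;> ring

lemma bitPoly_clmul (a b : ℕ) : bitPoly (clmul a b) = bitPoly a * bitPoly b :=
  bitPoly_clmulAux a _ b Nat.lt_log2_self

lemma natDegree_bitPoly_le {n k : ℕ} (h : n < 2 ^ (k + 1)) : (bitPoly n).natDegree ≤ k := by
  rw [natDegree_le_iff_coeff_eq_zero]
  intro i hi
  simp [bitPoly_coeff, Nat.testBit_lt_two_pow (h.trans_le (Nat.pow_le_pow_right two_pos hi))]

lemma le_natDegree_bitPoly {n k : ℕ} (h : 2 ^ k ≤ n) : k ≤ (bitPoly n).natDegree := by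
  have hn : n ≠ 0 := by have := Nat.two_pow_pos k; omega
  refine ((Nat.le_log2 hn).2 h).trans (le_natDegree_of_ne_zero ?_)
  simp [bitPoly_coeff, Nat.testBit_log2 hn]

lemma exists_bitPoly_eq {p : (ZMod 2)[X]} {k : ℕ} (h : p.natDegree < k) :
    ∃ n < 2 ^ k, bitPoly n = p := by
  refine ⟨Nat.ofBits fun i : Fin k => decide (p.coeff i = 1), Nat.ofBits_lt_two_pow _, ?_⟩
  ext i
  rw [bitPoly_coeff]
  by_cases hi : i < k
  · rw [Nat.testBit_ofBits_lt _ _ hi]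
    have hx : ∀ x : ZMod 2, x = 0 ∨ x = 1 := by decide
    rcases hx (p.coeff i) with h | h <;> simp [h]
  · rw [Nat.testBit_ofBits_ge _ _ (not_lt.1 hi), coeff_eq_zero_of_natDegree_lt (by omega)]
    simp

lemma bitPoly_coeff_zero (n : ℕ) : (bitPoly n).coeff 0 = 1 ↔ n % 2 = 1 := by
  simp [bitPoly_coeff]

lemma bitPoly_two : bitPoly 2 = X := by simpa using bitPoly_two_mul 1

lemma bitPoly_three : bitPoly 3 = 1 + X := by
  simpa [bitPoly_two] using bitPoly_xor 1 2

lemma bitPoly_seven : bitPoly 7 = X ^ 2 + X + 1 := by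
  have := bitPoly_xor 1 6
  rw [show 6 = 2 * 3 from rfl, bitPoly_two_mul, bitPoly_three] at this
  rw [show 7 = 1 ^^^ (2 * 3) from rfl, this, bitPoly_one]; ring

/-- The entries `(a, b, c, d)`, as binary expansions, of the `γ ∈ Γ₀(T³)` whose factor in the
product is at distance at least `2⁻⁴` from `1`. -/
def nearMatrices : List (ℕ × ℕ × ℕ × ℕ) :=
  [(1, 0, 0, 1), (1, 1, 0, 1), (1, 2, 0, 1), (1, 3, 0, 1), (1, 4, 0, 1), (1, 5, 0, 1), (1, 6, 0,
   1), (1, 7, 0, 1), (1, 8, 0, 1), (1, 9, 0, 1), (1, 10, 0, 1), (1, 11, 0, 1), (1, 12, 0, 1), (1,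
   13, 0, 1), (1, 14, 0, 1), (1, 15, 0, 1), (1, 0, 8, 1), (9, 1, 8, 1), (7, 1, 8, 3), (15, 2, 8,
   3), (5, 2, 8, 5), (13, 7, 8, 5), (3, 1, 8, 7), (11, 6, 8, 7), (19, 15, 8, 7), (27, 8, 8, 7),
   (35, 29, 8, 7), (43, 26, 8, 7), (51, 19, 8, 7), (59, 20, 8, 7), (3, 2, 8, 15), (1, 0, 16, 1),
   (5, 1, 16, 5), (7, 3, 16, 11), (13, 5, 16, 13), (3, 1, 16, 15), (19, 14, 16, 15), (1, 0, 24,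
   1), (7, 2, 24, 11), (9, 2, 32, 9), (11, 4, 32, 23), (13, 4, 32, 29), (3, 1, 32, 31), (11, 7,
   40, 31), (13, 3, 48, 13), (13, 1, 56, 5), (15, 4, 56, 19), (3, 1, 56, 23), (17, 4, 64, 17),
   (19, 13, 72, 55), (21, 5, 80, 21), (23, 14, 88, 59), (25, 6, 96, 25), (31, 10, 96, 35), (27,
   11, 104, 47), (29, 7, 112, 29), (25, 9, 112, 41), (31, 8, 120, 35), (35, 25, 136, 103), (39,
   26, 152, 107), (43, 31, 168, 127), (47, 28, 184, 115), (51, 21, 200, 87), (55, 22, 216, 91),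
   (59, 19, 232, 79), (63, 16, 248, 67)]

/-- Bounded universal quantification as a Boolean. -/
def allBelow (p : ℕ → Bool) : ℕ → Bool
  | 0 => true
  | n + 1 => p n && allBelow p n

lemma allBelow_spec {p : ℕ → Bool} {n : ℕ} (h : allBelow p n = true) {m : ℕ} (hm : m < n) :
    p m = true := by
  induction n with
  | zero => omega
  | succ n ih =>
    rw [allBelow, Bool.and_eq_true] at h
    rcases Nat.lt_succ_iff_lt_or_eq.1 hm with h' | rfl
    exacts [ih h.2 h', h.1]

/-- The test that `u + v = 1` and integrality of the upper right entry force the matrix determined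
by `c`, `d`, `e` and `f` to lie in `nearMatrices`. -/
def nearTest (c d e f u v : ℕ) : Bool :=
  !Nat.beq (Nat.xor u v) 1 ||
    (!Nat.beq ((clmul f 7 ^^^ 4 * e ^^^ d) % 4) 0 ||
      nearMatrices.elem (clmul e 3 ^^^ 2 * f ^^^ 2 * c, (clmul f 7 ^^^ 4 * e ^^^ d) / 4, 8 * c, d))

/-- The test of all quadruples with `c < 2 ^ i`, `d < 2 ^ (i + 1)` and `e, f < 2 ^ (j + 1)`, where
`d`, `e` and `f` are odd. -/
def nearSearch (i j : ℕ) : Bool :=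
  allBelow (fun c => allBelow (fun d' =>
    allBelow (fun e' => allBelow (fun f' =>
      nearTest c (2 * d' + 1) (2 * e' + 1) (2 * f' + 1)
        (clmul (clmul (2 * d' + 1) 3 ^^^ 8 * c) (2 * e' + 1))
        (clmul (2 * ((2 * d' + 1) ^^^ clmul c 7)) (2 * f' + 1)))
    (2 ^ j)) (2 ^ j)) (2 ^ i)) (2 ^ i)

set_option maxRecDepth 10000 in
lemma nearSearch_eq_true : allBelow (fun i => nearSearch i (6 - i)) 7 = true := by
  decide +kernel

section Ultrametric

variable {ι K : Type*} [NormedField K] [IsUltrametricDist K]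

lemma norm_add_eq_of_lt {x y : K} (h : ‖y‖ < ‖x‖) : ‖x + y‖ = ‖x‖ := by
  rw [IsUltrametricDist.norm_add_eq_max_of_norm_ne_norm h.ne', max_eq_left h.le]

lemma norm_prod_sub_one_le (f : ι → K) {ε : ℝ} (hε : 0 ≤ ε) (hε1 : ε < 1) (t : Finset ι)
    (h : ∀ i ∈ t, ‖f i - 1‖ ≤ ε) : ‖∏ i ∈ t, f i - 1‖ ≤ ε := by
  induction t using Finset.induction_on with
  | empty => simpa
  | insert a t ha ih =>
    rw [Finset.prod_insert ha]
    have h1 := ih fun i hi => h i (Finset.mem_insert_of_mem hi)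
    have h2 := h a (Finset.mem_insert_self a t)
    have h3 : f a * ∏ i ∈ t, f i - 1 = (f a - 1) * (∏ i ∈ t, f i - 1) + ((f a - 1) +
      (∏ i ∈ t, f i - 1)) := by ring
    rw [h3]
    refine (IsUltrametricDist.norm_add_le_max _ _).trans (max_le ?_ ?_)
    · rw [norm_mul]
      calc _ ≤ ε * 1 := mul_le_mul h2 (h1.trans hε1.le) (norm_nonneg _) hε
        _ = ε := mul_one ε
    · exact (IsUltrametricDist.norm_add_le_max _ _).trans (max_le h2 h1)

lemma norm_prod_sub_prod_le (f : ι → K) {ε : ℝ} (hε : 0 ≤ ε) (hε1 : ε < 1) {s t : Finset ι}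
    (hst : s ⊆ t) (h : ∀ i ∉ s, ‖f i - 1‖ ≤ ε) :
    ‖∏ i ∈ t, f i - ∏ i ∈ s, f i‖ ≤ ε * ‖∏ i ∈ s, f i‖ := by
  rw [← Finset.prod_sdiff hst, ← sub_one_mul, norm_mul]
  gcongr
  exact norm_prod_sub_one_le f hε hε1 _ fun i hi => h i (Finset.mem_sdiff.1 hi).2

lemma multipliable_of_finite_le_norm_sub_one [CompleteSpace K] (f : ι → K)
    (h : ∀ ε > 0, {i | ε ≤ ‖f i - 1‖}.Finite) : Multipliable f := by
  have hsmall (ε : ℝ) (hε : 0 < ε) : ∃ s : Finset ι, ∀ i ∉ s, ‖f i - 1‖ ≤ ε :=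
    ⟨(h ε hε).toFinset, fun i hi => by
      simpa using (not_le.1 (by simpa using hi)).le⟩
  obtain ⟨s₀, hs₀⟩ := hsmall (1 / 2) (by norm_num)
  set B := 2 * ‖∏ i ∈ s₀, f i‖ + 1
  have hB : 0 < B := by positivity
  have hbound (t : Finset ι) (ht : s₀ ⊆ t) : ‖∏ i ∈ t, f i‖ ≤ B := by
    have h1 := norm_prod_sub_prod_le f (by norm_num) (by norm_num) ht hs₀
    have h2 := norm_sub_norm_le (∏ i ∈ t, f i) (∏ i ∈ s₀, f i)
    have h3 := norm_nonneg (∏ i ∈ s₀, f i)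
    simp only [B]
    linarith
  rw [multipliable_iff_cauchySeq_finset, Metric.cauchySeq_iff']
  intro ε hε
  obtain ⟨s₁, hs₁⟩ := hsmall (min (1 / 2) (ε / (2 * B))) (by positivity)
  refine ⟨s₀ ∪ s₁, fun t ht => ?_⟩
  rw [dist_eq_norm]
  calc _ ≤ min (1 / 2) (ε / (2 * B)) * ‖∏ i ∈ s₀ ∪ s₁, f i‖ :=
        norm_prod_sub_prod_le f (by positivity)
          ((min_le_left _ _).trans_lt (by norm_num)) ht fun i hi => hs₁ i (by simp_all)
    _ ≤ ε / (2 * B) * B := by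
        gcongr
        exacts [min_le_right _ _, hbound _ Finset.subset_union_left]
    _ < ε := by field_simp; linarith

lemma norm_tprod_sub_prod_le {f : ι → K} (hf : Multipliable f) {ε : ℝ} (hε : 0 ≤ ε)
    (hε1 : ε < 1) (s : Finset ι) (h : ∀ i ∉ s, ‖f i - 1‖ ≤ ε) :
    ‖∏' i, f i - ∏ i ∈ s, f i‖ ≤ ε * ‖∏ i ∈ s, f i‖ := by
  have h1 : Filter.Tendsto (fun t => ‖∏ i ∈ t, f i - ∏ i ∈ s, f i‖) Filter.atTop
      (nhds ‖∏' i, f i - ∏ i ∈ s, f i‖) := (hf.hasProd.sub_const _).norm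
  refine le_of_tendsto h1 ?_
  filter_upwards [Filter.eventually_ge_atTop s] with t ht
  exact norm_prod_sub_prod_le f hε hε1 ht h

end Ultrametric

/-- Multiplication of elements `x.1 * ρ + x.2` of `F₂[T][ρ]`, where `ρ² = ρ + 1`. -/
def pairMul (x y : ℕ × ℕ) : ℕ × ℕ :=
  (clmul x.1 y.1 ^^^ clmul x.1 y.2 ^^^ clmul x.2 y.1, clmul x.2 y.2 ^^^ clmul x.1 y.1)

/-- The product of a list of elements of `F₂[T][ρ]`. -/
def pairProd (l : List (ℕ × ℕ)) : ℕ × ℕ :=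
  l.foldr (fun x y => pairMul y x) (0, 1)

/-- `ratioNum` on binary expansions. -/
def numPair (t : ℕ × ℕ × ℕ × ℕ) : ℕ × ℕ :=
  let (a, b, c, d) := t
  pairMul (4 * a ^^^ c, 4 * (4 * b ^^^ d)) (clmul c 7 ^^^ 8 * d, 4 * (c ^^^ clmul d 3))

/-- `ratioDen` on binary expansions. -/
def denPair (t : ℕ × ℕ × ℕ × ℕ) : ℕ × ℕ :=
  let (a, b, c, d) := t
  pairMul (c, 4 * d) (clmul (4 * a ^^^ c) 7 ^^^ 8 * (4 * b ^^^ d),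
    4 * (4 * a ^^^ c ^^^ clmul (4 * b ^^^ d) 3))

/-- The test that `T² * P - Q` has degree less than `610` and that `Q` has degree at least `614`. -/
def productTest (P Q : ℕ × ℕ) : Bool :=
  decide (4 * P.1 ^^^ Q.1 < 2 ^ 610) && decide (4 * P.2 ^^^ Q.2 < 2 ^ 610) &&
    decide (2 ^ 614 ≤ Q.2)

set_option exponentiation.threshold 1000 in
lemma productTest_eq_true : productTest (pairProd (nearMatrices.map numPair))
    (pairProd (nearMatrices.map denPair)) = true := by
  decide +kernel

lemma nearMatrices_valid : ∀ t ∈ nearMatrices,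
    clmul t.1 t.2.2.2 ^^^ clmul t.2.1 t.2.2.1 = 1 ∧ t.2.2.1 = 8 * (t.2.2.1 / 8) := by
  decide +kernel

lemma nearMatrices_nodup : nearMatrices.Nodup := by
  decide +kernel

lemma norm_eq_one_of_root {K : Type*} [NormedField K] {ρ : K} (hρ : ρ ^ 2 + ρ + 1 = 0) :
    ‖ρ‖ = 1 := by
  have h : ρ ^ 3 = 1 := by linear_combination (ρ - 1) * hρ
  have h' : ‖ρ‖ ^ 3 = 1 := by rw [← norm_pow, h, norm_one]
  exact (pow_eq_one_iff_of_nonneg (norm_nonneg _) three_ne_zero).1 h'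

lemma norm_add_one_eq_one_of_root {K : Type*} [NormedField K] {ρ : K}
    (hρ : ρ ^ 2 + ρ + 1 = 0) : ‖ρ + 1‖ = 1 := by
  have h : ρ + 1 = -ρ ^ 2 := by linear_combination hρ
  rw [h, norm_neg, norm_pow, norm_eq_one_of_root hρ, one_pow]

section Field

variable {C : Type*} [NormedField C] [Algebra (LaurentSeries (ZMod 2)) C]

/-- The element `p * ρ + q` of `C`. -/
noncomputable def lin (ρ : C) (p q : (ZMod 2)[X]) : C := polyEmb2 C p * ρ + polyEmb2 C q

lemma two_eq_zero_of_algebra (C : Type*) [NormedField C] [Algebra (LaurentSeries (ZMod 2)) C] :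
    (2 : C) = 0 := by
  rw [← map_ofNat (polyEmb2 C) 2, show (OfNat.ofNat 2 : (ZMod 2)[X]) = 0 from CharTwo.two_eq_zero,
    map_zero]

lemma norm_polyEmb2_X
    (hext : ∀ x : LaurentSeries (ZMod 2), ‖algebraMap (LaurentSeries (ZMod 2)) C x‖ = absK2 x) :
    ‖polyEmb2 C X‖ = 2 := by
  have h : polyEmb2 C X = algebraMap (LaurentSeries (ZMod 2)) C Tel2 := by simp [polyEmb2]
  rw [h, hext, absK2, Tel2, if_neg (by simp), HahnSeries.order_single one_ne_zero]
  norm_num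

section Norm

variable [IsUltrametricDist C]

lemma norm_polyEmb2 (hT : ‖polyEmb2 C X‖ = 2) {p : (ZMod 2)[X]} (hp : p ≠ 0) :
    ‖polyEmb2 C p‖ = 2 ^ p.natDegree := by
  have hconst (a : ZMod 2) : ‖polyEmb2 C (Polynomial.C a)‖ ≤ 1 := by
    have ha : ∀ x : ZMod 2, x = 0 ∨ x = 1 := by decide
    rcases ha a with rfl | rfl <;> simp
  induction hn : p.natDegree generalizing p with
  | zero =>
    obtain ⟨a, rfl⟩ := natDegree_eq_zero.1 hn
    have ha : ∀ x : ZMod 2, x = 0 ∨ x = 1 := by decide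
    rcases ha a with rfl | rfl
    · simp at hp
    · simp
  | succ n ih =>
    have hd : p.divX.natDegree = n := by rw [natDegree_divX_eq_natDegree_tsub_one, hn]; rfl
    have hd0 : p.divX ≠ 0 := by
      rw [Ne, divX_eq_zero_iff]
      intro h
      rw [h] at hn
      simp at hn
    have h1 : ‖polyEmb2 C (p.divX * X)‖ = 2 ^ (n + 1) := by
      rw [map_mul, norm_mul, ih hd0 hd, hT, pow_succ]
    conv_lhs => rw [← divX_mul_X_add p, map_add]
    rw [norm_add_eq_of_lt, h1]
    rw [h1]
    exact (hconst _).trans_lt (one_lt_pow₀ one_lt_two n.succ_ne_zero)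

variable {ρ : C} (hρ : ρ ^ 2 + ρ + 1 = 0) (hT : ‖polyEmb2 C X‖ = 2)
include hρ hT

lemma norm_lin (p q : (ZMod 2)[X]) :
    ‖lin ρ p q‖ = max ‖polyEmb2 C p‖ ‖polyEmb2 C q‖ := by
  have h1 := norm_eq_one_of_root hρ
  by_cases h : ‖polyEmb2 C p‖ = ‖polyEmb2 C q‖
  · by_cases hq : q = 0
    · have : polyEmb2 C p = 0 := by simpa [hq] using h
      simp [lin, this, hq]
    have hp : p ≠ 0 := by
      rintro rfl
      simp [norm_polyEmb2 hT hq] at h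
      exact absurd h.symm (by positivity)
    have hdeg : p.natDegree = q.natDegree := by
      rw [norm_polyEmb2 hT hp, norm_polyEmb2 hT hq] at h
      exact pow_right_injective₀ two_pos (by norm_num) h
    have hs : ‖polyEmb2 C (p - q)‖ < ‖polyEmb2 C q‖ := by
      by_cases hpq : p - q = 0
      · rw [hpq, map_zero, norm_zero, norm_polyEmb2 hT hq]
        positivity
      · rw [norm_polyEmb2 hT hq, norm_polyEmb2 hT hpq]
        refine pow_lt_pow_right₀ one_lt_two ?_
        have hlead (r : (ZMod 2)[X]) (hr : r ≠ 0) : r.leadingCoeff = 1 := by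
          have hx : ∀ x : ZMod 2, x ≠ 0 → x = 1 := by decide
          exact hx _ (leadingCoeff_ne_zero.2 hr)
        have := degree_sub_lt_left (p := p) (q := q)
          (by rw [degree_eq_natDegree hp, degree_eq_natDegree hq, hdeg]) hp
          (by rw [hlead p hp, hlead q hq])
        rw [← hdeg]
        exact natDegree_lt_natDegree hpq this
    have hl : lin ρ p q = polyEmb2 C q * (ρ + 1) + polyEmb2 C (p - q) * ρ := by
      rw [lin, map_sub]; ring
    have hq1 : ‖polyEmb2 C q * (ρ + 1)‖ = ‖polyEmb2 C q‖ := by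
      rw [norm_mul, norm_add_one_eq_one_of_root hρ, mul_one]
    rw [hl, norm_add_eq_of_lt, hq1, h, max_self]
    rwa [hq1, norm_mul, h1, mul_one]
  · rw [lin, IsUltrametricDist.norm_add_eq_max_of_norm_ne_norm, norm_mul, h1, mul_one]
    rwa [norm_mul, h1, mul_one]

lemma two_pow_natDegree_le_norm_lin {p q : (ZMod 2)[X]} :
    (p ≠ 0 → 2 ^ p.natDegree ≤ ‖lin ρ p q‖) ∧ (q ≠ 0 → 2 ^ q.natDegree ≤ ‖lin ρ p q‖) := by
  rw [norm_lin hρ hT]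
  exact ⟨fun h => by rw [← norm_polyEmb2 hT h]; exact le_max_left _ _,
    fun h => by rw [← norm_polyEmb2 hT h]; exact le_max_right _ _⟩

lemma norm_lin_eq_two_pow {p q : (ZMod 2)[X]} (h : p ≠ 0 ∨ q ≠ 0) :
    ‖lin ρ p q‖ = 2 ^ max p.natDegree q.natDegree := by
  rw [norm_lin hρ hT]
  by_cases hp : p = 0
  · have hq : q ≠ 0 := by tauto
    rw [norm_polyEmb2 hT hq]
    simp [hp]
  by_cases hq : q = 0
  · rw [norm_polyEmb2 hT hp]
    simp [hq]
  rw [norm_polyEmb2 hT hp, norm_polyEmb2 hT hq]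
  exact ((pow_right_mono₀ one_le_two).map_max).symm

lemma norm_lin_le_two_pow {p q : (ZMod 2)[X]} {k : ℕ} (hp : p.natDegree ≤ k)
    (hq : q.natDegree ≤ k) : ‖lin ρ p q‖ ≤ 2 ^ k := by
  by_cases h : p = 0 ∧ q = 0
  · simp [h.1, h.2, lin]
  · rw [norm_lin_eq_two_pow hρ hT (by tauto)]
    exact pow_le_pow_right₀ one_le_two (max_le hp hq)

end Norm

/-- The row vector `(T², 1) * M * α`; its linear form at `ω` is the numerator of
`1/T² - M (α ω)`. -/
noncomputable def movedRow (M : Matrix (Fin 2) (Fin 2) (ZMod 2)[X]) : (ZMod 2)[X] × (ZMod 2)[X] :=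
  ((X ^ 2 * M 0 0 + M 1 0) * (X ^ 2 + X + 1) + (X ^ 2 * M 0 1 + M 1 1) * X ^ 3,
    (X ^ 2 * M 0 0 + M 1 0) + (X ^ 2 * M 0 1 + M 1 1) * (1 + X))

/-- The numerator of the factor of `M`, written in `F₂[T][ρ]`. -/
noncomputable def ratioNum (ρ : C) (M : Matrix (Fin 2) (Fin 2) (ZMod 2)[X]) : C :=
  lin ρ (X ^ 2 * M 0 0 + M 1 0) (X ^ 2 * (X ^ 2 * M 0 1 + M 1 1)) *
    lin ρ (M 1 0 * (X ^ 2 + X + 1) + M 1 1 * X ^ 3) (X ^ 2 * (M 1 0 + M 1 1 * (1 + X)))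

/-- The denominator of the factor of `M`, written in `F₂[T][ρ]`. -/
noncomputable def ratioDen (ρ : C) (M : Matrix (Fin 2) (Fin 2) (ZMod 2)[X]) : C :=
  lin ρ (M 1 0) (X ^ 2 * M 1 1) * lin ρ (movedRow M).1 (X ^ 2 * (movedRow M).2)

lemma mul_movedRow_fst_add_snd (M : Matrix (Fin 2) (Fin 2) (ZMod 2)[X]) :
    (1 + X) * (movedRow M).1 + X ^ 3 * (movedRow M).2 = X ^ 2 * M 0 0 + M 1 0 := by
  have h2 : (2 : (ZMod 2)[X]) = 0 := CharTwo.two_eq_zero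
  simp only [movedRow]
  linear_combination
    ((X ^ 2 * M 0 0 + M 1 0) * (X + X ^ 2 + X ^ 3) + (X ^ 2 * M 0 1 + M 1 1) * (X ^ 3 + X ^ 4)) * h2

lemma movedRow_fst_add_mul_snd (M : Matrix (Fin 2) (Fin 2) (ZMod 2)[X]) :
    (movedRow M).1 + (X ^ 2 + X + 1) * (movedRow M).2 = X ^ 2 * M 0 1 + M 1 1 := by
  have h2 : (2 : (ZMod 2)[X]) = 0 := CharTwo.two_eq_zero
  simp only [movedRow]
  linear_combination
    ((X ^ 2 * M 0 0 + M 1 0) * (X ^ 2 + X + 1) + (X ^ 2 * M 0 1 + M 1 1) * (X + X ^ 2 + X ^ 3)) * h2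

section Det

variable {M : Matrix (Fin 2) (Fin 2) (ZMod 2)[X]} (hM : M.det = 1)
include hM

lemma lower_row_ne_zero : M 1 0 ≠ 0 ∨ X ^ 2 * M 1 1 ≠ 0 := by
  by_contra! h
  have h1 : M 1 1 = 0 := by simpa using h.2
  simp [det_fin_two, h.1, h1] at hM

lemma movedRow_ne_zero : (movedRow M).1 ≠ 0 ∨ X ^ 2 * (movedRow M).2 ≠ 0 := by
  by_contra! h
  have h1 : (movedRow M).2 = 0 := by simpa using h.2
  have h2 := mul_movedRow_fst_add_snd M
  have h3 := movedRow_fst_add_mul_snd M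
  rw [det_fin_two] at hM
  rw [h.1, h1] at h2 h3
  have h4 : (X : (ZMod 2)[X]) ^ 2 = 0 := by linear_combination -X ^ 2 * hM - M 1 1 * h2 + M 1 0 * h3
  simp at h4

lemma lower_row_mul_alpha2_ne_zero :
    M 1 0 * (X ^ 2 + X + 1) + M 1 1 * X ^ 3 ≠ 0 ∨ X ^ 2 * (M 1 0 + M 1 1 * (1 + X)) ≠ 0 := by
  by_contra! h
  have h1 : M 1 0 + M 1 1 * (1 + X) = 0 := by simpa using h.2
  have h2 : (2 : (ZMod 2)[X]) = 0 := CharTwo.two_eq_zero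
  have hc : M 1 0 = 0 := by
    linear_combination (1 + X) * h.1 + X ^ 3 * h1 -
      (M 1 0 * (X + X ^ 2 + X ^ 3) + M 1 1 * (X ^ 3 + X ^ 4)) * h2
  have hd : M 1 1 = 0 := by
    linear_combination h.1 + (X ^ 2 + X + 1) * h1 -
      (M 1 0 * (X ^ 2 + X + 1) + M 1 1 * (X + X ^ 2 + X ^ 3)) * h2
  simp [det_fin_two, hc, hd] at hM

lemma ratioNum_sub_ratioDen {ρ : C} (hρ : ρ ^ 2 + ρ + 1 = 0) :
    ratioNum ρ M - ratioDen ρ M = polyEmb2 C (X ^ 5 * (1 + X)) * (ρ + 1) := by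
  have h2 : (2 : C) = 0 := two_eq_zero_of_algebra C
  have hdet := congrArg (polyEmb2 C) hM
  rw [det_fin_two] at hdet
  simp only [map_sub, map_mul, map_one] at hdet
  simp only [ratioNum, ratioDen, lin, movedRow, map_add, map_mul, map_pow, map_one]
  generalize polyEmb2 C (M 0 0) = a at *
  generalize polyEmb2 C (M 0 1) = b at *
  generalize polyEmb2 C (M 1 0) = c at *
  generalize polyEmb2 C (M 1 1) = d at *
  generalize polyEmb2 C X = T at *
  have key : ∀ g h : C, (g * ρ + T ^ 2 * h) * ((c * (T ^ 2 + T + 1) + d * T ^ 3) * ρ +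
      T ^ 2 * (c + d * (1 + T))) - (c * ρ + T ^ 2 * d) *
      ((g * (T ^ 2 + T + 1) + h * T ^ 3) * ρ + T ^ 2 * (g + h * (1 + T))) =
      (g * d - h * c) * (T ^ 3 * ρ ^ 2 + T ^ 2 * ρ * (1 + T) - T ^ 2 * (T ^ 2 + T + 1) * ρ - T ^ 4)
      := by
    intro g h; ring
  rw [key]
  have h3 : (T ^ 2 * a + c) * d - (T ^ 2 * b + d) * c = T ^ 2 := by linear_combination T ^ 2 * hdet
  rw [h3]
  linear_combination T ^ 5 * hρ - (T ^ 6 * (1 + ρ) + T ^ 5 * (1 + ρ)) * h2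

end Det

lemma act2_div (M : Matrix (Fin 2) (Fin 2) (ZMod 2)[X]) {u v : C} (hv : v ≠ 0) :
    act2 M (u / v) = (polyEmb2 C (M 0 0) * u + polyEmb2 C (M 0 1) * v) /
      (polyEmb2 C (M 1 0) * u + polyEmb2 C (M 1 1) * v) := by
  have h (a b : C) : a * (u / v) + b = (a * u + b * v) / v := by field_simp
  rw [act2, h, h, div_div_div_cancel_right₀ hv]

lemma inv_sq_sub_act2 (hT : polyEmb2 C X ≠ 0) (M : Matrix (Fin 2) (Fin 2) (ZMod 2)[X]) {u v : C}
    (hv : v ≠ 0) (huv : polyEmb2 C (M 1 0) * u + polyEmb2 C (M 1 1) * v ≠ 0) :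
    (polyEmb2 C X)⁻¹ ^ 2 - act2 M (u / v) =
      (polyEmb2 C (X ^ 2 * M 0 0 + M 1 0) * u + polyEmb2 C (X ^ 2 * M 0 1 + M 1 1) * v) /
        (polyEmb2 C X ^ 2 * (polyEmb2 C (M 1 0) * u + polyEmb2 C (M 1 1) * v)) := by
  have h2 : (2 : C) = 0 := two_eq_zero_of_algebra C
  rw [act2_div M hv]
  simp only [map_add, map_mul, map_pow]
  generalize hD : polyEmb2 C (M 1 0) * u + polyEmb2 C (M 1 1) * v = D at *
  field_simp
  linear_combination -hD - polyEmb2 C X ^ 2 * (polyEmb2 C (M 0 0) * u + polyEmb2 C (M 0 1) * v) * h2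

section Ratio

variable [IsUltrametricDist C] {ρ : C} (hρ : ρ ^ 2 + ρ + 1 = 0) (hT : ‖polyEmb2 C X‖ = 2)
include hρ hT

lemma lin_ne_zero {p q : (ZMod 2)[X]} (h : p ≠ 0 ∨ q ≠ 0) : lin ρ p q ≠ 0 := by
  rw [← norm_ne_zero_iff, norm_lin_eq_two_pow hρ hT h]
  positivity

variable {M : Matrix (Fin 2) (Fin 2) (ZMod 2)[X]} (hM : M.det = 1)
include hM

lemma factor_eq_ratioNum_div_ratioDen :
    ((polyEmb2 C X)⁻¹ ^ 2 - act2 M ((polyEmb2 C X)⁻¹ ^ 2 * ρ)) /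
      ((polyEmb2 C X)⁻¹ ^ 2 - act2 M (act2 alpha2 ((polyEmb2 C X)⁻¹ ^ 2 * ρ))) =
      ratioNum ρ M / ratioDen ρ M := by
  have hT0 : polyEmb2 C X ≠ 0 := by
    rw [← norm_ne_zero_iff, hT]
    norm_num
  have hω : (polyEmb2 C X)⁻¹ ^ 2 * ρ = ρ / polyEmb2 C X ^ 2 := by field_simp
  have hα : act2 alpha2 (ρ / polyEmb2 C X ^ 2) =
      lin ρ (X ^ 2 + X + 1) (X ^ 2) / lin ρ (X ^ 3) (X ^ 2 * (1 + X)) := by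
    rw [act2_div _ (pow_ne_zero 2 hT0)]
    simp only [alpha2, lin, of_apply, cons_val', cons_val_zero, cons_val_one, cons_val_fin_one,
      map_add, map_mul, map_pow, map_one]
    congr 1 <;> ring
  have h1 := lin_ne_zero hρ hT (lower_row_ne_zero hM)
  have h2 := lin_ne_zero hρ hT (movedRow_ne_zero hM)
  have h3 := lin_ne_zero hρ hT (lower_row_mul_alpha2_ne_zero hM)
  have h4 : lin ρ (X ^ 3) (X ^ 2 * (1 + X)) ≠ 0 := lin_ne_zero hρ hT (by simp)
  have e1 : polyEmb2 C (M 1 0) * ρ + polyEmb2 C (M 1 1) * polyEmb2 C X ^ 2 =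
      lin ρ (M 1 0) (X ^ 2 * M 1 1) := by
    simp only [lin, map_mul, map_pow]; ring
  have e2 : polyEmb2 C (M 1 0) * lin ρ (X ^ 2 + X + 1) (X ^ 2) +
      polyEmb2 C (M 1 1) * lin ρ (X ^ 3) (X ^ 2 * (1 + X)) =
      lin ρ (M 1 0 * (X ^ 2 + X + 1) + M 1 1 * X ^ 3) (X ^ 2 * (M 1 0 + M 1 1 * (1 + X))) := by
    simp only [lin, map_add, map_mul, map_pow, map_one]; ring
  have e3 : polyEmb2 C (X ^ 2 * M 0 0 + M 1 0) * lin ρ (X ^ 2 + X + 1) (X ^ 2) +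
      polyEmb2 C (X ^ 2 * M 0 1 + M 1 1) * lin ρ (X ^ 3) (X ^ 2 * (1 + X)) =
      lin ρ (movedRow M).1 (X ^ 2 * (movedRow M).2) := by
    simp only [movedRow, lin, map_add, map_mul, map_pow, map_one]; ring
  have e4 : polyEmb2 C (X ^ 2 * M 0 0 + M 1 0) * ρ +
      polyEmb2 C (X ^ 2 * M 0 1 + M 1 1) * polyEmb2 C X ^ 2 =
      lin ρ (X ^ 2 * M 0 0 + M 1 0) (X ^ 2 * (X ^ 2 * M 0 1 + M 1 1)) := by
    simp only [lin, map_add, map_mul, map_pow]; ring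
  rw [hω, hα, inv_sq_sub_act2 hT0 M h4 (e2 ▸ h3),
    inv_sq_sub_act2 hT0 M (pow_ne_zero 2 hT0) (e1 ▸ h1), e1, e2, e3, e4, ratioNum, ratioDen]
  field_simp

lemma ratioDen_ne_zero : ratioDen ρ M ≠ 0 :=
  mul_ne_zero (lin_ne_zero hρ hT (lower_row_ne_zero hM)) (lin_ne_zero hρ hT (movedRow_ne_zero hM))

lemma norm_ratio_sub_one_mul :
    ‖ratioNum ρ M / ratioDen ρ M - 1‖ * (‖lin ρ (M 1 0) (X ^ 2 * M 1 1)‖ *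
      ‖lin ρ (movedRow M).1 (X ^ 2 * (movedRow M).2)‖) = 2 ^ 6 := by
  have h := ratioDen_ne_zero hρ hT hM
  have hd : (X ^ 5 * (1 + X) : (ZMod 2)[X]).natDegree = 6 := by
    rw [add_comm, ← C_1, natDegree_X_pow_mul 5 (X_add_C_ne_zero 1), natDegree_X_add_C]
  rw [← norm_mul, ← ratioDen, ← norm_mul, sub_mul, div_mul_cancel₀ _ h, one_mul,
    ratioNum_sub_ratioDen hM hρ, norm_mul, norm_add_one_eq_one_of_root hρ, mul_one,
    norm_polyEmb2 hT (by rintro h; simp [h] at hd), hd]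

lemma natDegree_le_of_norm_lin_mul_lt {N : ℕ} (h : ‖lin ρ (M 1 0) (X ^ 2 * M 1 1)‖ *
      ‖lin ρ (movedRow M).1 (X ^ 2 * (movedRow M).2)‖ < 2 ^ (N + 1)) :
    max (M 1 0).natDegree (X ^ 2 * M 1 1).natDegree +
      max (movedRow M).1.natDegree (X ^ 2 * (movedRow M).2).natDegree ≤ N := by
  rw [norm_lin_eq_two_pow hρ hT (lower_row_ne_zero hM),
    norm_lin_eq_two_pow hρ hT (movedRow_ne_zero hM), ← pow_add] at h
  exact Nat.lt_succ_iff.1 ((pow_lt_pow_iff_right₀ one_lt_two).1 h)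

end Ratio

end Field

lemma natDegree_X_sq_mul {p : (ZMod 2)[X]} (hp : p ≠ 0) :
    (X ^ 2 * p).natDegree = p.natDegree + 2 := natDegree_X_pow_mul 2 hp

lemma ext_of_movedRow {M N : Matrix (Fin 2) (Fin 2) (ZMod 2)[X]} (h0 : M 1 0 = N 1 0)
    (h1 : M 1 1 = N 1 1) (h : movedRow M = movedRow N) : M = N := by
  have hX : (X : (ZMod 2)[X]) ^ 2 ≠ 0 := pow_ne_zero 2 X_ne_zero
  have h2 := mul_movedRow_fst_add_snd M
  have h3 := movedRow_fst_add_mul_snd M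
  rw [h, mul_movedRow_fst_add_snd, h0, add_left_inj] at h2
  rw [h, movedRow_fst_add_mul_snd, h1, add_left_inj] at h3
  have h4 := mul_left_cancel₀ hX h2
  have h5 := mul_left_cancel₀ hX h3
  refine Matrix.ext fun i j => ?_
  fin_cases i <;> fin_cases j
  exacts [h4.symm, h5.symm, h0, h1]

lemma natDegree_le_of_X_sq_mul {p : (ZMod 2)[X]} {k : ℕ} (h : (X ^ 2 * p).natDegree ≤ k) :
    p.natDegree ≤ k := by
  by_cases hp : p = 0
  · simp [hp]
  · rw [natDegree_X_sq_mul hp] at h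
    omega

lemma finite_natDegree_le (k : ℕ) : {p : (ZMod 2)[X] | p.natDegree ≤ k}.Finite :=
  ((Set.finite_Iio (2 ^ (k + 1))).image bitPoly).subset fun _ hp =>
    exists_bitPoly_eq (Nat.lt_succ_of_le hp)

lemma finite_natDegree_movedRow_le (k : ℕ) :
    {M : Matrix (Fin 2) (Fin 2) (ZMod 2)[X] |
      max (M 1 0).natDegree (X ^ 2 * M 1 1).natDegree +
      max (movedRow M).1.natDegree (X ^ 2 * (movedRow M).2).natDegree ≤ k}.Finite := by
  have hf := finite_natDegree_le k
  refine Set.Finite.of_finite_image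
    (f := fun M => ((M 1 0, M 1 1), movedRow M))
    (((hf.prod hf).prod (hf.prod hf)).subset ?_) fun M _ N _ h => ?_
  · rintro _ ⟨M, hM, rfl⟩
    rw [Set.mem_ofPred_eq] at hM
    have h1 := le_max_left (M 1 0).natDegree (X ^ 2 * M 1 1).natDegree
    have h2 := le_max_right (M 1 0).natDegree (X ^ 2 * M 1 1).natDegree
    have h3 := le_max_left (movedRow M).1.natDegree (X ^ 2 * (movedRow M).2).natDegree
    have h4 := le_max_right (movedRow M).1.natDegree (X ^ 2 * (movedRow M).2).natDegree
    refine ⟨⟨?_, natDegree_le_of_X_sq_mul ?_⟩, ?_, natDegree_le_of_X_sq_mul ?_⟩ <;>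
      simp only [Set.mem_ofPred_eq] <;> omega
  · simp only [Prod.mk.injEq] at h
    exact ext_of_movedRow h.1.1 h.1.2 h.2

lemma bitPoly_four_mul (n : ℕ) : bitPoly (4 * n) = X ^ 2 * bitPoly n := by
  rw [show 4 * n = 2 * (2 * n) by ring, bitPoly_two_mul, bitPoly_two_mul]; ring

lemma bitPoly_eight_mul (n : ℕ) : bitPoly (8 * n) = X ^ 3 * bitPoly n := by
  rw [show 8 * n = 2 * (4 * n) by ring, bitPoly_two_mul, bitPoly_four_mul]; ring

/-- The matrix with entries given by the binary expansions in `t`. -/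
noncomputable def bitMatrix (t : ℕ × ℕ × ℕ × ℕ) : Matrix (Fin 2) (Fin 2) (ZMod 2)[X] :=
  !![bitPoly t.1, bitPoly t.2.1; bitPoly t.2.2.1, bitPoly t.2.2.2]

lemma bitMatrix_injective : Function.Injective bitMatrix := fun s t h => by
  have h00 := congrFun (congrFun h 0) 0
  have h01 := congrFun (congrFun h 0) 1
  have h10 := congrFun (congrFun h 1) 0
  have h11 := congrFun (congrFun h 1) 1
  simp only [bitMatrix, of_apply, cons_val', cons_val_zero, cons_val_one, cons_val_fin_one]
    at h00 h01 h10 h11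
  exact Prod.ext (bitPoly_injective h00) (Prod.ext (bitPoly_injective h01)
    (Prod.ext (bitPoly_injective h10) (bitPoly_injective h11)))

lemma bitMatrix_mem_Gamma0T3 {t : ℕ × ℕ × ℕ × ℕ} (ht : t ∈ nearMatrices) :
    bitMatrix t ∈ Gamma0T3 := by
  obtain ⟨h1, h2⟩ := nearMatrices_valid t ht
  have h := congrArg bitPoly h1
  rw [bitPoly_xor, bitPoly_clmul, bitPoly_clmul, bitPoly_one] at h
  refine ⟨?_, ?_⟩
  · rw [det_fin_two, CharTwo.sub_eq_add]
    exact h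
  · change _ ∣ bitPoly t.2.2.1
    rw [h2, bitPoly_eight_mul]
    exact dvd_mul_right _ _

lemma mem_nearMatrices_of_equation {i c d e f : ℕ} (hi : i ≤ 6) (hc : c < 2 ^ i)
    (hd : d < 2 ^ (i + 1)) (he : e < 2 ^ (6 - i + 1)) (hf : f < 2 ^ (6 - i + 1))
    (hd2 : d % 2 = 1) (he2 : e % 2 = 1) (hf2 : f % 2 = 1)
    (h1 : clmul (clmul d 3 ^^^ 8 * c) e ^^^ clmul (2 * (d ^^^ clmul c 7)) f = 1)
    (h4 : (clmul f 7 ^^^ 4 * e ^^^ d) % 4 = 0) :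
    (clmul e 3 ^^^ 2 * f ^^^ 2 * c, (clmul f 7 ^^^ 4 * e ^^^ d) / 4, 8 * c, d) ∈ nearMatrices := by
  have h := allBelow_spec nearSearch_eq_true (Nat.lt_succ_of_le hi)
  have hd' : d / 2 < 2 ^ i := by rw [pow_succ] at hd; omega
  have he' : e / 2 < 2 ^ (6 - i) := by rw [pow_succ] at he; omega
  have hf' : f / 2 < 2 ^ (6 - i) := by rw [pow_succ] at hf; omega
  have h := allBelow_spec (allBelow_spec (allBelow_spec (allBelow_spec h hc) hd') he') hf'
  rw [show 2 * (d / 2) + 1 = d by omega, show 2 * (e / 2) + 1 = e by omega,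
    show 2 * (f / 2) + 1 = f by omega] at h
  have h1' : Nat.beq (Nat.xor (clmul (clmul d 3 ^^^ 8 * c) e)
      (clmul (2 * (d ^^^ clmul c 7)) f)) 1 = true := Nat.beq_eq ▸ h1
  rw [nearTest, h1', h4] at h
  simpa using h

lemma exists_mem_nearMatrices {M : Matrix (Fin 2) (Fin 2) (ZMod 2)[X]} (hM : M ∈ Gamma0T3)
    (hdeg : max (M 1 0).natDegree (X ^ 2 * M 1 1).natDegree +
      max (movedRow M).1.natDegree (X ^ 2 * (movedRow M).2).natDegree ≤ 10) :
    ∃ t ∈ nearMatrices, bitMatrix t = M := by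
  obtain ⟨hdet, c, hc⟩ := hM
  have h2 : (2 : (ZMod 2)[X]) = 0 := CharTwo.two_eq_zero
  have hX : (X : (ZMod 2)[X]) ^ 2 ≠ 0 := pow_ne_zero 2 X_ne_zero
  obtain ⟨e, he⟩ : ∃ e, e = (M 0 0 + X * c) * (X ^ 2 + X + 1) + X * (X ^ 2 * M 0 1 + M 1 1) :=
    ⟨_, rfl⟩
  have hE : (movedRow M).1 = X ^ 2 * e := by
    rw [movedRow, hc, he]; ring
  have hs1 := mul_movedRow_fst_add_snd M
  have hs2 := movedRow_fst_add_mul_snd M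
  have hf : (movedRow M).2 = (X ^ 2 * M 0 0 + X ^ 3 * c) + (X ^ 2 * M 0 1 + M 1 1) * (1 + X) := by
    rw [movedRow, hc]
  rw [det_fin_two] at hdet
  rw [hE] at hs1 hs2 hdeg
  rw [hc] at hs1 hdet hdeg
  generalize (movedRow M).2 = f at hs1 hs2 hdeg hf
  have h0 := congrArg (fun p => p.coeff 0) hdet
  simp [mul_coeff_zero] at h0
  obtain ⟨ha0, hd0⟩ := h0
  have he0 : e.coeff 0 = 1 := by simp [he, mul_coeff_zero, ha0]
  have hf0 : f.coeff 0 = 1 := by simp [hf, mul_coeff_zero, hd0]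
  have hne {p : (ZMod 2)[X]} (hp : p.coeff 0 = 1) : p ≠ 0 := by
    rintro rfl
    simp at hp
  rw [natDegree_X_sq_mul (hne hd0), natDegree_X_sq_mul (hne he0), natDegree_X_sq_mul (hne hf0)]
    at hdeg
  obtain ⟨i, hi⟩ : ∃ i, max (X ^ 3 * c).natDegree ((M 1 1).natDegree + 2) = i + 2 :=
    Nat.exists_eq_add_of_le' ((Nat.le_add_left 2 _).trans (le_max_right _ _))
  obtain ⟨cn, hcn, rfl⟩ : ∃ n < 2 ^ i, bitPoly n = c := by
    by_cases hc0 : c = 0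
    · exact ⟨0, by positivity, by simp [hc0]⟩
    · refine exists_bitPoly_eq ?_
      rw [natDegree_X_pow_mul 3 hc0] at hi
      omega
  obtain ⟨dn, hdn, hd⟩ := exists_bitPoly_eq (p := M 1 1) (k := i + 1) (by omega)
  obtain ⟨en, hen, rfl⟩ := exists_bitPoly_eq (p := e) (k := 6 - i + 1) (by omega)
  obtain ⟨fn, hfn, rfl⟩ := exists_bitPoly_eq (p := f) (k := 6 - i + 1) (by omega)
  obtain ⟨bn, -, hb⟩ := exists_bitPoly_eq (p := M 0 1) (Nat.lt_succ_self _)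
  rw [bitPoly_coeff_zero] at he0 hf0
  rw [← hd, bitPoly_coeff_zero] at hd0
  have hN : clmul fn 7 ^^^ 4 * en ^^^ dn = 4 * bn := bitPoly_injective (by
    rw [bitPoly_xor, bitPoly_xor, bitPoly_clmul, bitPoly_seven, bitPoly_four_mul, bitPoly_four_mul,
      hd, hb]
    linear_combination hs2 + M 1 1 * h2)
  have heq : clmul (clmul dn 3 ^^^ 8 * cn) en ^^^ clmul (2 * (dn ^^^ clmul cn 7)) fn = 1 :=
    bitPoly_injective (by
      simp only [bitPoly_xor, bitPoly_clmul, bitPoly_seven, bitPoly_three, bitPoly_eight_mul,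
        bitPoly_two_mul, hd, bitPoly_one]
      refine mul_left_cancel₀ hX ?_
      linear_combination M 1 1 * hs1 + X ^ 3 * bitPoly cn * hs2 + X ^ 2 * hdet +
        (X ^ 3 * bitPoly cn * M 1 1 + X ^ 5 * bitPoly cn * M 0 1) * h2)
  have hmem := mem_nearMatrices_of_equation (by omega) hcn hdn hen hfn hd0 he0 hf0 heq (by omega)
  refine ⟨_, hmem, Matrix.ext fun j k => ?_⟩
  have ha : bitPoly (clmul en 3 ^^^ 2 * fn ^^^ 2 * cn) = M 0 0 := by
    simp only [bitPoly_xor, bitPoly_clmul, bitPoly_three, bitPoly_two_mul]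
    refine mul_left_cancel₀ hX ?_
    linear_combination hs1 + X ^ 3 * bitPoly cn * h2
  fin_cases j <;> fin_cases k
  · exact ha
  · change bitPoly ((clmul fn 7 ^^^ 4 * en ^^^ dn) / 4) = M 0 1
    rw [hN, Nat.mul_div_cancel_left _ (by norm_num), hb]
  · change bitPoly (8 * cn) = M 1 0
    rw [bitPoly_eight_mul, hc]
  · exact hd

section Product

variable {C : Type*} [NormedField C] [Algebra (LaurentSeries (ZMod 2)) C]
  {ρ : C} (hρ : ρ ^ 2 + ρ + 1 = 0)

/-- The element of `C` represented by a pair of binary expansions. -/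
noncomputable def pairValue (ρ : C) (x : ℕ × ℕ) : C := lin ρ (bitPoly x.1) (bitPoly x.2)

include hρ

lemma pairValue_pairMul (x y : ℕ × ℕ) :
    pairValue ρ (pairMul x y) = pairValue ρ x * pairValue ρ y := by
  have h2 : (2 : C) = 0 := two_eq_zero_of_algebra C
  simp only [pairValue, pairMul, lin, bitPoly_xor, bitPoly_clmul, map_add, map_mul]
  linear_combination -polyEmb2 C (bitPoly x.1) * polyEmb2 C (bitPoly y.1) * hρ +
    polyEmb2 C (bitPoly x.1) * polyEmb2 C (bitPoly y.1) * (1 + ρ) * h2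

lemma pairValue_pairProd (l : List (ℕ × ℕ)) :
    pairValue ρ (pairProd l) = (l.map (pairValue ρ)).prod := by
  induction l with
  | nil => simp [pairProd, pairValue, lin]
  | cons x l ih =>
    rw [List.map_cons, List.prod_cons, ← ih, mul_comm, ← pairValue_pairMul hρ]
    rfl

lemma pairValue_numPair (t : ℕ × ℕ × ℕ × ℕ) :
    pairValue ρ (numPair t) = ratioNum ρ (bitMatrix t) := by
  obtain ⟨a, b, c, d⟩ := t
  rw [numPair, pairValue_pairMul hρ]
  simp only [pairValue, ratioNum, bitMatrix, of_apply, cons_val', cons_val_zero, cons_val_one,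
    cons_val_fin_one, bitPoly_xor, bitPoly_clmul, bitPoly_four_mul, bitPoly_eight_mul,
    bitPoly_seven, bitPoly_three]
  ring_nf

lemma pairValue_denPair (t : ℕ × ℕ × ℕ × ℕ) :
    pairValue ρ (denPair t) = ratioDen ρ (bitMatrix t) := by
  obtain ⟨a, b, c, d⟩ := t
  rw [denPair, pairValue_pairMul hρ]
  simp only [pairValue, ratioDen, movedRow, bitMatrix, of_apply, cons_val', cons_val_zero,
    cons_val_one, cons_val_fin_one, bitPoly_xor, bitPoly_clmul, bitPoly_four_mul,
    bitPoly_eight_mul, bitPoly_seven, bitPoly_three]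
  ring_nf

variable [IsUltrametricDist C]

set_option exponentiation.threshold 1000 in
lemma norm_prod_nearMatrices_sub_le (hT : ‖polyEmb2 C X‖ = 2) :
    ‖(nearMatrices.map fun t => ratioNum ρ (bitMatrix t) / ratioDen ρ (bitMatrix t)).prod -
      (polyEmb2 C X)⁻¹ ^ 2‖ ≤ 2⁻¹ ^ 7 := by
  have hdiv (l : List (ℕ × ℕ × ℕ × ℕ)) :
      (l.map fun t => ratioNum ρ (bitMatrix t) / ratioDen ρ (bitMatrix t)).prod =
        pairValue ρ (pairProd (l.map numPair)) / pairValue ρ (pairProd (l.map denPair)) := by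
    rw [pairValue_pairProd hρ, pairValue_pairProd hρ]
    induction l with
    | nil => simp
    | cons t l ih =>
      simp only [List.map_cons, List.prod_cons, ih, pairValue_numPair hρ, pairValue_denPair hρ]
      rw [mul_div_mul_comm]
  rw [hdiv]
  have htest := productTest_eq_true
  generalize pairProd (nearMatrices.map numPair) = P at *
  generalize pairProd (nearMatrices.map denPair) = Q at *
  simp only [productTest, Bool.and_eq_true, decide_eq_true_eq] at htest
  obtain ⟨⟨h1, h2⟩, h3⟩ := htest
  have hQ0 : bitPoly Q.2 ≠ 0 := by
    intro h
    rw [bitPoly_injective (h.trans bitPoly_zero.symm)] at h3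
    exact absurd h3 (by norm_num)
  have hQ : (2 : ℝ) ^ 614 ≤ ‖pairValue ρ Q‖ :=
    (pow_le_pow_right₀ one_le_two (le_natDegree_bitPoly h3)).trans
      ((two_pow_natDegree_le_norm_lin hρ hT).2 hQ0)
  have hQpos : 0 < ‖pairValue ρ Q‖ := lt_of_lt_of_le (by positivity) hQ
  have hD : ‖polyEmb2 C X ^ 2 * pairValue ρ P - pairValue ρ Q‖ ≤ 2 ^ 609 := by
    have h4 : polyEmb2 C X ^ 2 * pairValue ρ P - pairValue ρ Q =
        pairValue ρ (4 * P.1 ^^^ Q.1, 4 * P.2 ^^^ Q.2) := by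
      simp only [pairValue, lin, bitPoly_xor, bitPoly_four_mul, map_add, map_mul, map_pow]
      linear_combination -(polyEmb2 C (bitPoly Q.1) * ρ + polyEmb2 C (bitPoly Q.2)) *
        two_eq_zero_of_algebra C
    rw [h4]
    exact norm_lin_le_two_pow hρ hT (natDegree_bitPoly_le h1) (natDegree_bitPoly_le h2)
  have hT0 : polyEmb2 C X ≠ 0 := by
    rw [← norm_ne_zero_iff, hT]
    norm_num
  have hQ1 : pairValue ρ Q ≠ 0 := norm_pos_iff.1 hQpos
  have h5 : pairValue ρ P / pairValue ρ Q - (polyEmb2 C X)⁻¹ ^ 2 =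
      (polyEmb2 C X ^ 2 * pairValue ρ P - pairValue ρ Q) / (polyEmb2 C X ^ 2 * pairValue ρ Q) := by
    field_simp
  rw [h5, norm_div, norm_mul, norm_pow, hT, div_le_iff₀ (by positivity)]
  calc _ ≤ (2 : ℝ) ^ 609 := hD
    _ = 2⁻¹ ^ 7 * (2 ^ 2 * 2 ^ 614) := by norm_num
    _ ≤ _ := by gcongr

end Product

/-- **Part of Proposition 8.1.**  With `ω = T⁻²·ρ` (`ρ² + ρ + 1 = 0`), the family
`γ ↦ (1/T² - γω)/(1/T² - γ(αω))`, indexed by `γ ∈ Γ = Γ₀(T³)`, is multipliable, and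
its product `u_α(1/T²)` satisfies `|u_α(1/T²) - π²| < 2⁻⁶`, `π = 1/T`. -/
theorem u_alpha_at_one_over_T_sq {C : Type*} [NormedField C] [CompleteSpace C]
    [Algebra (LaurentSeries (ZMod 2)) C]
    (hna : ∀ x y : C, ‖x + y‖ ≤ max ‖x‖ ‖y‖)
    (hext : ∀ x : LaurentSeries (ZMod 2), ‖algebraMap (LaurentSeries (ZMod 2)) C x‖ = absK2 x)
    (ρ : C) (hρ : ρ ^ 2 + ρ + 1 = 0)
    (ω : C) (hω : ω = (polyEmb2 C Polynomial.X) ⁻¹ ^ 2 * ρ) :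
    Multipliable (fun γ : Gamma0T3 =>
      ((polyEmb2 C Polynomial.X)⁻¹ ^ 2 - act2 γ.val ω) /
        ((polyEmb2 C Polynomial.X)⁻¹ ^ 2 - act2 γ.val (act2 alpha2 ω))) ∧
    ‖(∏' γ : Gamma0T3, ((polyEmb2 C Polynomial.X)⁻¹ ^ 2 - act2 γ.val ω) /
          ((polyEmb2 C Polynomial.X)⁻¹ ^ 2 - act2 γ.val (act2 alpha2 ω)))
        - (polyEmb2 C Polynomial.X)⁻¹ ^ 2‖ < (2 : ℝ) ^ (-6 : ℤ) := by
  have : IsUltrametricDist C := IsUltrametricDist.isUltrametricDist_of_forall_norm_add_le_max_norm hna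
  have hT := norm_polyEmb2_X hext
  subst hω
  have hfactor (γ : Gamma0T3) := factor_eq_ratioNum_div_ratioDen hρ hT γ.2.1
  simp only [hfactor]
  have hdist (γ : Gamma0T3) := norm_ratio_sub_one_mul hρ hT γ.2.1
  have hpos (γ : Gamma0T3) : 0 < ‖lin ρ (γ.val 1 0) (X ^ 2 * γ.val 1 1)‖ *
      ‖lin ρ (movedRow γ.val).1 (X ^ 2 * (movedRow γ.val).2)‖ :=
    mul_pos (norm_pos_iff.2 (lin_ne_zero hρ hT (lower_row_ne_zero γ.2.1)))
      (norm_pos_iff.2 (lin_ne_zero hρ hT (movedRow_ne_zero γ.2.1)))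
  have hmult : Multipliable fun γ : Gamma0T3 => ratioNum ρ γ.val / ratioDen ρ γ.val := by
    refine multipliable_of_finite_le_norm_sub_one _ fun ε hε => ?_
    obtain ⟨N, hN⟩ := pow_unbounded_of_one_lt (2 ^ 6 / ε) (one_lt_two (α := ℝ))
    refine ((finite_natDegree_movedRow_le N).preimage Subtype.val_injective.injOn).subset
      fun γ hγ => natDegree_le_of_norm_lin_mul_lt hρ hT γ.2.1 ?_
    have h1 : ε * _ ≤ (2 : ℝ) ^ 6 := (mul_le_mul_of_nonneg_right hγ (hpos γ).le).trans (hdist γ).le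
    rw [mul_comm, ← le_div_iff₀ hε] at h1
    exact (h1.trans_lt hN).trans (pow_lt_pow_right₀ one_lt_two N.lt_succ_self)
  refine ⟨hmult, ?_⟩
  set S' : Finset (Matrix (Fin 2) (Fin 2) (ZMod 2)[X]) := (nearMatrices.map bitMatrix).toFinset
  have hS' : ∀ M ∈ S', M ∈ Gamma0T3 := by
    intro M hM
    obtain ⟨t, ht, rfl⟩ := List.mem_map.1 (List.mem_toFinset.1 hM)
    exact bitMatrix_mem_Gamma0T3 ht
  set S : Finset Gamma0T3 := S'.subtype (· ∈ Gamma0T3)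
  have hfar : ∀ γ ∉ S, ‖ratioNum ρ γ.val / ratioDen ρ γ.val - 1‖ ≤ 2⁻¹ ^ 5 := by
    intro γ hγ
    by_contra! h
    refine hγ (Finset.mem_subtype.2 (List.mem_toFinset.2 (List.mem_map.2
      (exists_mem_nearMatrices γ.2 (natDegree_le_of_norm_lin_mul_lt hρ hT γ.2.1 ?_)))))
    have h1 := (mul_lt_mul_of_pos_right h (hpos γ)).trans_eq (hdist γ)
    norm_num at h1 ⊢
    linarith
  have hprod : ∏ γ ∈ S, ratioNum ρ γ.val / ratioDen ρ γ.val =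
      (nearMatrices.map fun t => ratioNum ρ (bitMatrix t) / ratioDen ρ (bitMatrix t)).prod := by
    rw [Finset.prod_subtype_of_mem (fun M => ratioNum ρ M / ratioDen ρ M) hS',
      List.prod_toFinset _ (nearMatrices_nodup.map bitMatrix_injective), List.map_map]
    rfl
  have hnear := norm_prod_nearMatrices_sub_le hρ hT
  rw [← hprod] at hnear
  have hs : ‖(polyEmb2 C X)⁻¹ ^ 2‖ = 2⁻¹ ^ 2 := by rw [norm_pow, norm_inv, hT]
  have hS : ‖∏ γ ∈ S, ratioNum ρ γ.val / ratioDen ρ γ.val‖ ≤ 2⁻¹ ^ 2 := by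
    rw [← sub_add_cancel (∏ γ ∈ S, ratioNum ρ γ.val / ratioDen ρ γ.val) ((polyEmb2 C X)⁻¹ ^ 2)]
    exact (IsUltrametricDist.norm_add_le_max _ _).trans
      (max_le (hnear.trans (by norm_num)) hs.le)
  have htail := norm_tprod_sub_prod_le hmult (by norm_num) (by norm_num) S hfar
  rw [← sub_add_sub_cancel _ (∏ γ ∈ S, ratioNum ρ γ.val / ratioDen ρ γ.val)]
  refine (IsUltrametricDist.norm_add_le_max _ _).trans_lt (max_lt ?_ ?_)
  · calc _ ≤ 2⁻¹ ^ 5 * (2⁻¹ ^ 2 : ℝ) := htail.trans (by gcongr)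
      _ < _ := by norm_num
  · exact hnear.trans_lt (by norm_num)
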